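/- Regge-trajectory asymptotics, odd offset (consequence of the Regge asymptotics theorem of Section 5.3). Fix an odd natural number Δ ≥ 1, an integer D ≥ 4, and real r > -1 and μ with 2r + μ + 1 ≠ 0. Then there exists N such that for every integer n ≥ N, the coefficient B^1_{n,n-Δ}(r,μ,D) is nonzero and has the same strict sign as 2r + μ + 1 (positive if 2r + μ + 1 > 0, negative if 2r + μ + 1 < 0). -/

import Mathlib

open MeasureTheory

/-- Rising factorial `(y)_(k) = y (y+1) ⋯ (y+k-1)`. -/
noncomputable def risingFactorial (y : ℝ) (k : ℕ) : ℝ := ∏ i ∈ Finset.range k, (y + i)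

/-- Partial-wave coefficient `B^a_{n,j}(r,μ,D)` of the hypergeometric amplitude,
normalized up to an inessential positive constant depending only on `j` and `D`. -/
noncomputable def B (a n j : ℕ) (r μ D : ℝ) : ℝ :=
  (1 / risingFactorial (r + 1) n) *
    ∫ x in (-1:ℝ)..1,
      (1 - x ^ 2) ^ ((D - 4) / 2 + (j : ℝ)) *
        iteratedDeriv j
          (fun y : ℝ =>
            risingFactorial (((n : ℝ) - 3 * μ) * y / 2 + (μ - (n : ℝ)) / 2 + r + 1) (n - 1 + a)) x

open Filter Topology

/-- Coefficients of the power series `exp (c t ^ 2)`. -/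
noncomputable def expSqCoeff (c : ℝ) (k : ℕ) : ℝ :=
  if Even k then c ^ (k / 2) / ((k / 2).factorial : ℝ) else 0

theorem expSqCoeff_two_mul (c : ℝ) (m : ℕ) :
    expSqCoeff c (2 * m) = c ^ m / (m.factorial : ℝ) := by
  simp [expSqCoeff]

theorem expSqCoeff_of_odd (c : ℝ) {k : ℕ} (hk : Odd k) : expSqCoeff c k = 0 := by
  simp [expSqCoeff, Nat.not_even_iff_odd.2 hk]

theorem expSqCoeff_add_two (c : ℝ) (k : ℕ) :
    ((k : ℝ) + 2) * expSqCoeff c (k + 2) = 2 * c * expSqCoeff c k := by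
  rcases Nat.even_or_odd' k with ⟨m, rfl | rfl⟩
  · rw [show 2 * m + 2 = 2 * (m + 1) by ring, expSqCoeff_two_mul, expSqCoeff_two_mul,
      Nat.factorial_succ]
    push_cast
    have : (m.factorial : ℝ) ≠ 0 := by positivity
    field_simp
    ring
  · rw [expSqCoeff_of_odd c ⟨m, rfl⟩, expSqCoeff_of_odd c ⟨m + 1, by ring⟩]
    simp

theorem sum_antidiagonal_expSqCoeff_mul (a b : ℝ) (N : ℕ) :
    ∑ x ∈ Finset.HasAntidiagonal.antidiagonal N, expSqCoeff a x.1 * expSqCoeff b x.2 =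
      expSqCoeff (a + b) N := by
  rcases Nat.even_or_odd' N with ⟨m, rfl | rfl⟩
  · rw [expSqCoeff_two_mul, (Commute.all a b).add_pow', Finset.sum_div]
    symm
    refine Finset.sum_of_injOn (fun x : ℕ × ℕ => (2 * x.1, 2 * x.2)) ?_ ?_ ?_ ?_
    · rintro ⟨x, y⟩ - ⟨z, t⟩ - h
      simp only [Prod.mk.injEq] at h ⊢
      omega
    · rintro ⟨x, y⟩ h
      simp only [Finset.mem_coe,
        Finset.HasAntidiagonal.mem_antidiagonal] at h ⊢
      omega
    · rintro ⟨x, y⟩ h h'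
      simp only [Finset.HasAntidiagonal.mem_antidiagonal] at h
      rcases Nat.even_or_odd' x with ⟨k, rfl | rfl⟩
      · exfalso
        apply h'
        refine ⟨(k, y / 2), ?_, ?_⟩
        · simp only [Finset.mem_coe, Finset.HasAntidiagonal.mem_antidiagonal]
          omega
        · simp only [Prod.mk.injEq, true_and]
          omega
      · simp [expSqCoeff_of_odd a (k := 2 * k + 1) ⟨k, rfl⟩]
    · rintro ⟨x, y⟩ h
      simp only [Finset.HasAntidiagonal.mem_antidiagonal] at h
      subst h
      simp only [expSqCoeff_two_mul, nsmul_eq_mul]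
      rw [Nat.cast_add_choose]
      have h1 : ((x + y).factorial : ℝ) ≠ 0 := by positivity
      have h2 : (x.factorial : ℝ) ≠ 0 := by positivity
      have h3 : (y.factorial : ℝ) ≠ 0 := by positivity
      field_simp
  · rw [expSqCoeff_of_odd _ ⟨m, rfl⟩]
    refine Finset.sum_eq_zero ?_
    rintro ⟨x, y⟩ h
    simp only [Finset.HasAntidiagonal.mem_antidiagonal] at h
    rcases Nat.even_or_odd x with hx | hx
    · rw [expSqCoeff_of_odd b (k := y) (by grind), mul_zero]
    · rw [expSqCoeff_of_odd a hx, zero_mul]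

/-- The moments `∫ x ^ l (1 - x ^ 2) ^ s` over `[-1, 1]`. -/
noncomputable def moment (s : ℝ) (l : ℕ) : ℝ :=
  ∫ x in (-1 : ℝ)..1, (1 - x ^ 2) ^ s * x ^ l

theorem continuous_one_sub_sq_rpow {s : ℝ} (hs : 0 ≤ s) :
    Continuous fun x : ℝ => (1 - x ^ 2) ^ s :=
  (by fun_prop : Continuous fun x : ℝ => 1 - x ^ 2).rpow_const fun _ => Or.inr hs

theorem moment_of_odd (s : ℝ) {l : ℕ} (hl : Odd l) : moment s l = 0 := by
  have h := intervalIntegral.integral_comp_neg (a := (-1 : ℝ)) (b := 1)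
    (fun x : ℝ => (1 - x ^ 2) ^ s * x ^ l)
  simp only [even_two.neg_pow, hl.neg_pow, mul_neg, neg_neg, intervalIntegral.integral_neg] at h
  unfold moment
  linarith

theorem moment_zero_pos {s : ℝ} (hs : 0 ≤ s) : 0 < moment s 0 := by
  unfold moment
  refine intervalIntegral.intervalIntegral_pos_of_pos_on ?_ ?_ (by norm_num)
  · exact ((continuous_one_sub_sq_rpow hs).mul (by fun_prop)).intervalIntegrable _ _
  · intro x hx
    have : 0 < 1 - x ^ 2 := by nlinarith [hx.1, hx.2]
    simpa using Real.rpow_pos_of_pos this s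

theorem moment_add_two {s : ℝ} (hs : 0 ≤ s) (l : ℕ) :
    (2 * s + l + 3) * moment s (l + 2) = (l + 1) * moment s l := by
  have hd : ∀ x : ℝ, x ∈ Set.uIcc (-1 : ℝ) 1 →
      HasDerivAt (fun x : ℝ => (1 - x ^ 2) ^ (s + 1) * x ^ (l + 1))
        ((l + 1) * ((1 - x ^ 2) ^ s * x ^ l) -
          (2 * s + l + 3) * ((1 - x ^ 2) ^ s * x ^ (l + 2))) x := by
    intro x hx
    rw [Set.uIcc_of_le (by norm_num)] at hx
    have h0 : 0 ≤ 1 - x ^ 2 := by nlinarith [hx.1, hx.2]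
    have h1 : HasDerivAt (fun x : ℝ => 1 - x ^ 2) (-(2 * x)) x := by
      simpa using (hasDerivAt_pow 2 x).const_sub 1
    have h2 := (h1.rpow_const (p := s + 1) (Or.inr (by linarith))).mul
      (hasDerivAt_pow (l + 1) x)
    refine h2.congr_deriv ?_
    have h3 : (1 - x ^ 2) ^ (s + 1) = (1 - x ^ 2) ^ s * (1 - x ^ 2) :=
      Real.rpow_add_one' h0 (by linarith)
    rw [h3]
    simp only [add_sub_cancel_right, Nat.add_sub_cancel]
    push_cast
    ring
  have hi : ∀ k : ℕ, IntervalIntegrable (fun x : ℝ => (1 - x ^ 2) ^ s * x ^ k) volume (-1) 1 :=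
    fun k => ((continuous_one_sub_sq_rpow hs).mul (by fun_prop)).intervalIntegrable _ _
  have h := intervalIntegral.integral_eq_sub_of_hasDerivAt hd
    (((hi l).const_mul _).sub ((hi (l + 2)).const_mul _))
  rw [intervalIntegral.integral_sub ((hi l).const_mul _) ((hi (l + 2)).const_mul _),
    intervalIntegral.integral_const_mul, intervalIntegral.integral_const_mul] at h
  norm_num [Real.zero_rpow (by linarith : s + 1 ≠ 0)] at h
  unfold moment
  linarith

/-- The points `i - (n - 1) / 2`, `i < n`, symmetric about the origin. -/
noncomputable def centeredNode (n : ℕ) (i : Fin n) : ℝ := (i : ℝ) - ((n : ℝ) - 1) / 2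

/-- Elementary symmetric polynomials of the centered nodes. -/
noncomputable def centeredEsymm (n k : ℕ) : ℝ :=
  MvPolynomial.aeval (centeredNode n) (MvPolynomial.esymm (Fin n) ℝ k)

/-- Power sums of the centered nodes. -/
noncomputable def centeredPsum (n k : ℕ) : ℝ := ∑ i, centeredNode n i ^ k

theorem centeredNode_rev (n : ℕ) (i : Fin n) : centeredNode n i.rev = -centeredNode n i := by
  unfold centeredNode
  rw [Fin.val_rev, Nat.cast_sub (by omega)]
  push_cast
  ring

theorem abs_centeredNode_le (n : ℕ) (i : Fin n) : |centeredNode n i| ≤ n := by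
  have h1 : ((i : ℕ) : ℝ) + 1 ≤ n := by exact_mod_cast i.2
  have h2 : (0 : ℝ) ≤ ((i : ℕ) : ℝ) := by positivity
  unfold centeredNode
  rw [abs_le]
  constructor <;> linarith

theorem centeredPsum_of_odd (n : ℕ) {k : ℕ} (hk : Odd k) : centeredPsum n k = 0 := by
  have h : centeredPsum n k = -centeredPsum n k := by
    unfold centeredPsum
    rw [← Finset.sum_neg_distrib, ← Equiv.sum_comp Fin.revPerm]
    simp [centeredNode_rev, hk.neg_pow]
  linarith

theorem centeredPsum_two (n : ℕ) : centeredPsum n 2 = (n : ℝ) * ((n : ℝ) ^ 2 - 1) / 12 := by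
  have h : ∀ (c : ℝ) (m : ℕ), ∑ i ∈ Finset.range m, ((i : ℝ) - c) ^ 2 =
      (m : ℝ) * (m - 1) * (2 * m - 1) / 6 - c * m * (m - 1) + m * c ^ 2 := by
    intro c m
    induction m with
    | zero => simp
    | succ m ih =>
      rw [Finset.sum_range_succ, ih]
      push_cast
      ring
  unfold centeredPsum centeredNode
  rw [Fin.sum_univ_eq_sum_range (fun i => ((i : ℝ) - ((n : ℝ) - 1) / 2) ^ 2), h]
  ring

theorem abs_centeredPsum_le (n k : ℕ) : |centeredPsum n k| ≤ (n : ℝ) ^ (k + 1) := by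
  unfold centeredPsum
  refine (Finset.abs_sum_le_sum_abs _ _).trans ?_
  refine (Finset.sum_le_sum (g := fun _ => (n : ℝ) ^ k) fun i _ => ?_).trans ?_
  · rw [abs_pow]
    exact pow_le_pow_left₀ (abs_nonneg _) (abs_centeredNode_le n i) k
  · simp [pow_succ']

theorem centeredEsymm_zero (n : ℕ) : centeredEsymm n 0 = 1 := by
  simp [centeredEsymm]

theorem centeredEsymm_succ (n k : ℕ) :
    ((k : ℝ) + 1) * centeredEsymm n (k + 1) =
      ∑ i ∈ Finset.range (k + 1),
        (-1) ^ (k + i) * (centeredEsymm n i * centeredPsum n (k + 1 - i)) := by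
  have hp : ∀ j, MvPolynomial.aeval (centeredNode n) (MvPolynomial.psum (Fin n) ℝ j) =
      centeredPsum n j := by
    intro j
    simp [MvPolynomial.psum, centeredPsum]
  have h := congrArg (MvPolynomial.aeval (centeredNode n))
    (MvPolynomial.mul_esymm_eq_sum (Fin n) ℝ (k + 1))
  simp only [map_mul, map_sum, map_pow, map_neg, map_one, map_natCast, hp] at h
  rw [Finset.sum_filter, Finset.Nat.sum_antidiagonal_eq_sum_range_succ_mk,
    Finset.sum_range_succ] at h
  simp only [lt_irrefl, if_false, add_zero] at h
  rw [Nat.cast_succ] at h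
  unfold centeredEsymm
  rw [h, Finset.mul_sum]
  refine Finset.sum_congr rfl fun i hi => ?_
  rw [if_pos (by simpa using hi)]
  ring

theorem centeredEsymm_of_odd (n : ℕ) {k : ℕ} (hk : Odd k) : centeredEsymm n k = 0 := by
  induction k using Nat.strong_induction_on with
  | _ k ih =>
    obtain ⟨k, rfl⟩ : ∃ l, k = l + 1 := ⟨k - 1, by grind⟩
    have h := centeredEsymm_succ n k
    rw [Finset.sum_eq_zero] at h
    · have : (k : ℝ) + 1 ≠ 0 := by positivity
      simpa [this] using h
    · intro i hi
      rw [Finset.mem_range] at hi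
      rcases Nat.even_or_odd i with h' | h'
      · rw [centeredPsum_of_odd n (by grind), mul_zero, mul_zero]
      · rw [ih i hi h', zero_mul, mul_zero]

theorem tendsto_sqrt_natCast_atTop : Tendsto (fun n : ℕ => √(n : ℝ)) atTop atTop :=
  Real.tendsto_sqrt_atTop.comp tendsto_natCast_atTop_atTop

theorem tendsto_centeredPsum_div {k : ℕ} (hk : k ≠ 0) :
    Tendsto (fun n : ℕ => centeredPsum n k / √(n : ℝ) ^ (3 * k)) atTop
      (𝓝 (if k = 2 then 1 / 12 else 0)) := by
  split_ifs with h2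
  · subst h2
    have h : Tendsto (fun n : ℕ => (1 - ((n : ℝ)⁻¹) ^ 2) / 12) atTop (𝓝 ((1 - 0 ^ 2) / 12)) :=
      ((tendsto_inv_atTop_nhds_zero_nat.pow 2).const_sub 1).div_const 12
    norm_num at h
    norm_num
    refine h.congr' ?_
    filter_upwards [eventually_gt_atTop 0] with n hn
    have hn' : (n : ℝ) ≠ 0 := by positivity
    rw [centeredPsum_two, show √(n : ℝ) ^ 6 = (√(n : ℝ) ^ 2) ^ 3 by ring,
      Real.sq_sqrt (by positivity)]
    field_simp
  · rcases Nat.even_or_odd k with he | ho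
    · have h0 : Tendsto (fun n : ℕ => (√(n : ℝ))⁻¹) atTop (𝓝 0) :=
        tendsto_sqrt_natCast_atTop.inv_tendsto_atTop
      refine squeeze_zero_norm' ?_ h0
      filter_upwards [eventually_gt_atTop 0] with n hn
      have hn' : (1 : ℝ) ≤ n := by exact_mod_cast hn
      have hq : 1 ≤ √(n : ℝ) := Real.one_le_sqrt.2 hn'
      have hq0 : 0 < √(n : ℝ) := by linarith
      rw [norm_div, Real.norm_eq_abs, Real.norm_eq_abs, abs_of_pos (pow_pos hq0 (3 * k)),
        div_le_iff₀ (by positivity)]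
      refine (abs_centeredPsum_le n k).trans ?_
      have h3 : (n : ℝ) ^ (k + 1) = √(n : ℝ) ^ (2 * k + 2) := by
        rw [show 2 * k + 2 = 2 * (k + 1) by ring, pow_mul, Real.sq_sqrt (by positivity)]
      have h4 : (√(n : ℝ))⁻¹ * √(n : ℝ) ^ (3 * k) = √(n : ℝ) ^ (3 * k - 1) := by
        rw [inv_mul_eq_iff_eq_mul₀ hq0.ne', ← pow_succ']
        congr 1
        omega
      rw [h3, h4]
      exact pow_le_pow_right₀ hq (by grind)
    · simp [centeredPsum_of_odd _ ho]

theorem tendsto_centeredEsymm_div (k : ℕ) :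
    Tendsto (fun n : ℕ => centeredEsymm n k / √(n : ℝ) ^ (3 * k)) atTop
      (𝓝 (expSqCoeff (-1 / 24) k)) := by
  induction k using Nat.strong_induction_on with
  | _ k ih =>
    rcases k with _ | k
    · simp [centeredEsymm_zero, expSqCoeff]
    have hlim : Tendsto (fun n : ℕ => (∑ i ∈ Finset.range (k + 1), (-1) ^ (k + i) *
        (centeredEsymm n i / √(n : ℝ) ^ (3 * i) *
          (centeredPsum n (k + 1 - i) / √(n : ℝ) ^ (3 * (k + 1 - i))))) / ((k : ℝ) + 1)) atTop
        (𝓝 ((∑ i ∈ Finset.range (k + 1), (-1) ^ (k + i) *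
          (expSqCoeff (-1 / 24) i * (if k + 1 - i = 2 then 1 / 12 else 0))) / ((k : ℝ) + 1))) := by
      refine (tendsto_finsetSum _ fun i hi => ?_).div_const _
      rw [Finset.mem_range] at hi
      exact ((ih i hi).mul (tendsto_centeredPsum_div (by omega))).const_mul _
    have hval : (∑ i ∈ Finset.range (k + 1), (-1 : ℝ) ^ (k + i) *
          (expSqCoeff (-1 / 24) i * (if k + 1 - i = 2 then 1 / 12 else 0))) / ((k : ℝ) + 1) =
        expSqCoeff (-1 / 24) (k + 1) := by
      rcases k with _ | k
      · simp [expSqCoeff]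
      · have h := expSqCoeff_add_two (-1 / 24) k
        rw [Finset.sum_eq_single k]
        · rw [if_pos (by omega), show k + 1 + k = 2 * k + 1 by ring, pow_succ, pow_mul]
          push_cast
          rw [div_eq_iff (by positivity)]
          norm_num
          linarith
        · intro i hi hik
          rw [if_neg (by omega), mul_zero, mul_zero]
        · simp
    rw [← hval]
    refine hlim.congr' ?_
    filter_upwards [eventually_gt_atTop 0] with n hn
    have hq0 : √(n : ℝ) ≠ 0 := by positivity
    have hk0 : (k : ℝ) + 1 ≠ 0 := by positivity
    rw [div_eq_div_iff hk0 (by positivity), mul_comm (centeredEsymm n (k + 1)),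
      centeredEsymm_succ, Finset.sum_mul]
    refine Finset.sum_congr rfl fun i hi => ?_
    rw [Finset.mem_range] at hi
    have h3 : √(n : ℝ) ^ (3 * (k + 1)) = √(n : ℝ) ^ (3 * i) * √(n : ℝ) ^ (3 * (k + 1 - i)) := by
      rw [← pow_add]
      congr 1
      omega
    rw [h3]
    field_simp

theorem tendsto_centeredEsymm_div_descFactorial (k : ℕ) :
    Tendsto (fun n : ℕ => centeredEsymm n k / (n.descFactorial k : ℝ) / √(n : ℝ) ^ k) atTop
      (𝓝 (expSqCoeff (-1 / 24) k)) := by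
  have h1 : Tendsto (fun n : ℕ => (n.descFactorial k : ℝ) / (n : ℝ) ^ k) atTop (𝓝 1) := by
    have hz : ∀ᶠ n : ℕ in atTop, (n : ℝ) ^ k ≠ 0 := by
      filter_upwards [eventually_gt_atTop 0] with n hn
      positivity
    exact (Asymptotics.isEquivalent_iff_tendsto_one hz).1 (isEquivalent_descFactorial k)
  have h2 := (tendsto_centeredEsymm_div k).div h1 one_ne_zero
  rw [div_one] at h2
  refine h2.congr' ?_
  filter_upwards [eventually_gt_atTop k] with n hn
  have hn0 : 0 < n := by omega
  have hq0 : √(n : ℝ) ≠ 0 := by positivity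
  have hd : (n.descFactorial k : ℝ) ≠ 0 := by
    exact_mod_cast (Nat.descFactorial_pos.2 hn.le).ne'
  have h3 : (n : ℝ) ^ k = √(n : ℝ) ^ (2 * k) := by
    rw [pow_mul, Real.sq_sqrt (by positivity)]
  simp only [Pi.div_apply]
  rw [h3, show 3 * k = 2 * k + k by ring, pow_add]
  field_simp

theorem tendsto_moment_div {c : ℝ} (hc : 0 ≤ c) (μ : ℝ) (d l : ℕ) :
    Tendsto (fun n : ℕ => (((n : ℝ) - 3 * μ) / 2) ^ l * moment (c + ((n - d : ℕ) : ℝ)) l /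
        moment (c + ((n - d : ℕ) : ℝ)) 0 / √(n : ℝ) ^ l) atTop
      (𝓝 ((l.factorial : ℝ) * expSqCoeff (1 / 16) l)) := by
  have hs : ∀ n : ℕ, 0 ≤ c + ((n - d : ℕ) : ℝ) := fun n => by positivity
  induction l using Nat.twoStepInduction with
  | zero => simp [expSqCoeff, (moment_zero_pos (hs _)).ne']
  | one => simp [moment_of_odd _ odd_one, expSqCoeff_of_odd _ odd_one]
  | more l ih _ =>
    have hinv : ∀ a : ℝ, Tendsto (fun n : ℕ => a / (n : ℝ)) atTop (𝓝 0) :=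
      fun a => tendsto_const_div_atTop_nhds_zero_nat a
    have hlim : Tendsto (fun n : ℕ => (1 - 3 * μ / (n : ℝ)) ^ 2 / 4 * ((l : ℝ) + 1) /
        (2 + (2 * c - 2 * d + l + 3) / (n : ℝ))) atTop
        (𝓝 ((1 - 0) ^ 2 / 4 * ((l : ℝ) + 1) / (2 + 0))) :=
      (((((hinv _).const_sub 1).pow 2).div_const 4).mul_const _).div
        ((hinv _).const_add 2) (by norm_num)
    have hprod := ih.mul hlim
    have hval : (l.factorial : ℝ) * expSqCoeff (1 / 16) l *
        ((1 - 0) ^ 2 / 4 * ((l : ℝ) + 1) / (2 + 0)) =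
        ((l + 2).factorial : ℝ) * expSqCoeff (1 / 16) (l + 2) := by
      have h := expSqCoeff_add_two (1 / 16) l
      rw [Nat.factorial_succ, Nat.factorial_succ]
      push_cast
      linear_combination (-(l.factorial : ℝ) * (l + 1)) * h
    rw [← hval]
    refine hprod.congr' ?_
    filter_upwards [eventually_gt_atTop d] with n hn
    have hn0 : 0 < n := by omega
    have hn' : (n : ℝ) ≠ 0 := by positivity
    have hq0 : √(n : ℝ) ≠ 0 := by positivity
    have hrec := moment_add_two (hs n) l
    have hM := (moment_zero_pos (hs n)).ne'
    have hden : 2 * (c + ((n - d : ℕ) : ℝ)) + l + 3 ≠ 0 := by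
      have := hs n
      positivity
    have hden' : 2 + (2 * c - 2 * d + l + 3) / (n : ℝ) =
        (2 * (c + ((n - d : ℕ) : ℝ)) + l + 3) / n := by
      rw [Nat.cast_sub hn.le]
      field_simp
      ring
    have hrec' : moment (c + ((n - d : ℕ) : ℝ)) (l + 2) =
        (l + 1) * moment (c + ((n - d : ℕ) : ℝ)) l /
          (2 * (c + ((n - d : ℕ) : ℝ)) + l + 3) := by
      rw [eq_div_iff hden, ← hrec, mul_comm]
    rw [hden', hrec', pow_add (√(n : ℝ)) l 2, Real.sq_sqrt (by positivity), pow_add _ l 2]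
    generalize 2 * (c + ((n - d : ℕ) : ℝ)) + l + 3 = K at *
    field_simp
    ring

theorem prod_add_centeredNode (n : ℕ) (x : ℝ) :
    ∏ i, (x + centeredNode n i) =
      ∑ k ∈ Finset.range (n + 1), centeredEsymm n k * x ^ (n - k) := by
  have h := congrArg (Polynomial.eval x) (Multiset.prod_X_add_C_eq_sum_esymm
    ((Finset.univ : Finset (Fin n)).val.map (centeredNode n)))
  rw [Multiset.map_map] at h
  change Polynomial.eval x (∏ i, (Polynomial.X + Polynomial.C (centeredNode n i))) = _ at h
  simpa [Polynomial.eval_prod, Polynomial.eval_finsetSum, centeredEsymm,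
    MvPolynomial.aeval_esymm_eq_multiset_esymm] using h

theorem risingFactorial_eq_sum (n : ℕ) (r μ y : ℝ) :
    risingFactorial (((n : ℝ) - 3 * μ) * y / 2 + (μ - (n : ℝ)) / 2 + r + 1) n =
      ∑ k ∈ Finset.range (n + 1), centeredEsymm n k *
        (((n : ℝ) - 3 * μ) / 2 * y + (2 * r + μ + 1) / 2) ^ (n - k) := by
  rw [← prod_add_centeredNode, risingFactorial, ← Fin.prod_univ_eq_prod_range
    (fun i => ((n : ℝ) - 3 * μ) * y / 2 + (μ - (n : ℝ)) / 2 + r + 1 + (i : ℝ))]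
  refine Finset.prod_congr rfl fun i _ => ?_
  unfold centeredNode
  ring

theorem iteratedDeriv_linear_pow (s w x : ℝ) (m j : ℕ) :
    iteratedDeriv j (fun y : ℝ => (s * y + w) ^ m) x =
      s ^ j * ((m.descFactorial j : ℝ) * (s * x + w) ^ (m - j)) := by
  have h := iteratedDeriv_comp_const_mul (n := j) (f := fun z : ℝ => (z + w) ^ m)
    (by fun_prop) s
  rw [h, iteratedDeriv_comp_add_const j (fun z : ℝ => z ^ m) w]
  simp only [iteratedDeriv_pow]

theorem descFactorial_sub_eq {n d k : ℕ} (hd : d ≤ n) (hk : k ≤ d) :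
    ((n - k).descFactorial (n - d) : ℝ) =
      (n.factorial : ℝ) / (n.descFactorial k * (d - k).factorial) := by
  have h1 := Nat.factorial_mul_descFactorial (n := n - k) (k := n - d) (by omega)
  have h2 := Nat.factorial_mul_descFactorial (n := n) (k := k) (by omega)
  rw [show n - k - (n - d) = d - k by omega] at h1
  have h3 : (n.descFactorial k : ℝ) ≠ 0 := by
    exact_mod_cast (Nat.descFactorial_pos.2 (hk.trans hd)).ne'
  rw [eq_div_iff (by positivity), ← h2, ← h1]
  push_cast
  ring

theorem iteratedDeriv_risingFactorial {n d : ℕ} (hd : d ≤ n) (r μ x : ℝ) :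
    iteratedDeriv (n - d) (fun y : ℝ =>
        risingFactorial (((n : ℝ) - 3 * μ) * y / 2 + (μ - (n : ℝ)) / 2 + r + 1) n) x =
      (((n : ℝ) - 3 * μ) / 2) ^ (n - d) * n.factorial *
        ∑ k ∈ Finset.range (d + 1), centeredEsymm n k / n.descFactorial k *
          ((((n : ℝ) - 3 * μ) / 2 * x + (2 * r + μ + 1) / 2) ^ (d - k) /
            (d - k).factorial) := by
  simp only [risingFactorial_eq_sum]
  rw [iteratedDeriv_fun_sum fun i _ => by fun_prop, Finset.mul_sum]
  simp only [iteratedDeriv_const_mul_field, iteratedDeriv_linear_pow]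
  symm
  refine Finset.sum_subset_zero_on_sdiff (Finset.range_subset_range.2 (by omega)) ?_ ?_
  · intro k hk
    simp only [Finset.mem_sdiff, Finset.mem_range] at hk
    rw [Nat.descFactorial_of_lt (by omega)]
    simp
  · intro k hk
    rw [Finset.mem_range] at hk
    rw [descFactorial_sub_eq hd (by omega), show n - k - (n - d) = d - k by omega]
    have h3 : (n.descFactorial k : ℝ) ≠ 0 := by
      exact_mod_cast (Nat.descFactorial_pos.2 (show k ≤ n by omega)).ne'
    field_simp

theorem add_pow_div_factorial (a b : ℝ) (p : ℕ) :
    (a + b) ^ p / (p.factorial : ℝ) =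
      ∑ l ∈ Finset.range (p + 1), a ^ l / l.factorial * (b ^ (p - l) / (p - l).factorial) := by
  rw [add_pow, Finset.sum_div]
  refine Finset.sum_congr rfl fun l hl => ?_
  rw [Nat.cast_choose ℝ (by simpa [Nat.lt_succ_iff] using hl)]
  have : (p.factorial : ℝ) ≠ 0 := by positivity
  field_simp

/-- The part of the normalized coefficient homogeneous of degree `N` in the centered nodes and
in the slope of the affine argument. -/
noncomputable def homogeneousPart (D μ : ℝ) (d n N : ℕ) : ℝ :=
  ∑ k ∈ Finset.range (N + 1), centeredEsymm n k / n.descFactorial k *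
    ((((n : ℝ) - 3 * μ) / 2) ^ (N - k) * moment ((D - 4) / 2 + ((n - d : ℕ) : ℝ)) (N - k) /
      moment ((D - 4) / 2 + ((n - d : ℕ) : ℝ)) 0 / (N - k).factorial)

theorem B_eq_sum_homogeneousPart {D : ℝ} (hD : 4 ≤ D) (r μ : ℝ) {n d : ℕ} (hn : 0 < n)
    (hd : d ≤ n) :
    B 1 n (n - d) r μ D =
      1 / risingFactorial (r + 1) n * ((((n : ℝ) - 3 * μ) / 2) ^ (n - d) * n.factorial *
        moment ((D - 4) / 2 + ((n - d : ℕ) : ℝ)) 0) *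
        ∑ N ∈ Finset.range (d + 1), ((2 * r + μ + 1) / 2) ^ (d - N) / (d - N).factorial *
          homogeneousPart D μ d n N := by
  have hs : 0 ≤ (D - 4) / 2 + ((n - d : ℕ) : ℝ) := by
    have : (0 : ℝ) ≤ ((n - d : ℕ) : ℝ) := by positivity
    linarith
  have hM := (moment_zero_pos hs).ne'
  have hcont : ∀ (a : ℝ) (l : ℕ), Continuous
      (fun x : ℝ => a * ((1 - x ^ 2) ^ ((D - 4) / 2 + ((n - d : ℕ) : ℝ)) * x ^ l)) := fun a l =>
    ((continuous_one_sub_sq_rpow hs).mul (by fun_prop)).const_mul a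
  unfold B homogeneousPart
  rw [Nat.sub_add_cancel hn, mul_assoc]
  congr 1
  simp only [iteratedDeriv_risingFactorial hd]
  generalize (2 * r + μ + 1) / 2 = w
  generalize ((n : ℝ) - 3 * μ) / 2 = s at *
  generalize (D - 4) / 2 + ((n - d : ℕ) : ℝ) = t at *
  have hpt : ∀ x : ℝ, (1 - x ^ 2) ^ t * (s ^ (n - d) * n.factorial *
      ∑ k ∈ Finset.range (d + 1), centeredEsymm n k / n.descFactorial k *
        ((s * x + w) ^ (d - k) / (d - k).factorial)) =
      ∑ k ∈ Finset.range (d + 1), ∑ l ∈ Finset.range (d + 1 - k),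
        (s ^ (n - d) * n.factorial * (centeredEsymm n k / n.descFactorial k *
          (s ^ l / l.factorial * (w ^ (d - k - l) / (d - k - l).factorial)))) *
          ((1 - x ^ 2) ^ t * x ^ l) := by
    intro x
    rw [Finset.mul_sum, Finset.mul_sum]
    refine Finset.sum_congr rfl fun k hk => ?_
    rw [Finset.mem_range] at hk
    rw [add_pow_div_factorial, Finset.mul_sum, Finset.mul_sum, Finset.mul_sum,
      show d - k + 1 = d + 1 - k by omega]
    refine Finset.sum_congr rfl fun l _ => ?_
    rw [mul_pow]
    ring
  simp only [hpt]
  rw [intervalIntegral.integral_finsetSum fun k _ =>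
    (continuous_finsetSum _ fun l _ => hcont _ l).intervalIntegrable _ _]
  simp only [intervalIntegral.integral_finsetSum fun l _ => (hcont _ l).intervalIntegrable _ _,
    intervalIntegral.integral_const_mul]
  rw [← Finset.sum_range_diag_flip (d + 1) (fun k l =>
    (s ^ (n - d) * n.factorial * (centeredEsymm n k / n.descFactorial k *
          (s ^ l / l.factorial * (w ^ (d - k - l) / (d - k - l).factorial)))) *
          ∫ x in (-1 : ℝ)..1, (1 - x ^ 2) ^ t * x ^ l), Finset.mul_sum]
  refine Finset.sum_congr rfl fun N _ => ?_
  rw [Finset.mul_sum, Finset.mul_sum]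
  refine Finset.sum_congr rfl fun k hk => ?_
  rw [Finset.mem_range] at hk
  rw [show d - k - (N - k) = d - N by omega]
  change _ * moment t (N - k) = _
  field_simp

theorem homogeneousPart_of_odd (D μ : ℝ) (d n : ℕ) {N : ℕ} (hN : Odd N) :
    homogeneousPart D μ d n N = 0 := by
  refine Finset.sum_eq_zero fun k hk => ?_
  rw [Finset.mem_range] at hk
  rcases Nat.even_or_odd k with h | h
  · rw [moment_of_odd _ (by grind)]
    simp
  · simp [centeredEsymm_of_odd n h]

theorem tendsto_homogeneousPart_div {D : ℝ} (hD : 4 ≤ D) (μ : ℝ) (d N : ℕ) :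
    Tendsto (fun n : ℕ => homogeneousPart D μ d n N / √(n : ℝ) ^ N) atTop
      (𝓝 (expSqCoeff (1 / 48) N)) := by
  have hval : ∑ k ∈ Finset.range (N + 1), expSqCoeff (-1 / 24) k *
      (((N - k).factorial : ℝ) * expSqCoeff (1 / 16) (N - k) / (N - k).factorial) =
      expSqCoeff (1 / 48) N := by
    have h := sum_antidiagonal_expSqCoeff_mul (-1 / 24) (1 / 16) N
    rw [Finset.Nat.sum_antidiagonal_eq_sum_range_succ_mk] at h
    norm_num at h
    rw [← h]
    refine Finset.sum_congr rfl fun k _ => ?_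
    have : ((N - k).factorial : ℝ) ≠ 0 := by positivity
    field_simp
  rw [← hval]
  refine Tendsto.congr' ?_ (tendsto_finsetSum (Finset.range (N + 1)) fun k _ =>
    (tendsto_centeredEsymm_div_descFactorial k).mul
      ((tendsto_moment_div (c := (D - 4) / 2) (by linarith) μ d (N - k)).div_const
        ((N - k).factorial : ℝ)))
  filter_upwards [eventually_gt_atTop 0] with n hn
  have hq0 : √(n : ℝ) ≠ 0 := by positivity
  rw [homogeneousPart, Finset.sum_div]
  refine Finset.sum_congr rfl fun k hk => ?_
  rw [Finset.mem_range] at hk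
  rw [show √(n : ℝ) ^ N = √(n : ℝ) ^ k * √(n : ℝ) ^ (N - k) by
    rw [← pow_add]; congr 1; omega]
  field_simp

theorem tendsto_sum_homogeneousPart_div {D : ℝ} (hD : 4 ≤ D) (μ w : ℝ) (m : ℕ) :
    Tendsto (fun n : ℕ => (∑ N ∈ Finset.range (2 * m + 1 + 1),
        w ^ (2 * m + 1 - N) / (2 * m + 1 - N).factorial *
          homogeneousPart D μ (2 * m + 1) n N) / √(n : ℝ) ^ (2 * m)) atTop
      (𝓝 (w * expSqCoeff (1 / 48) (2 * m))) := by
  have hlow : ∀ N ∈ Finset.range (2 * m), Tendsto (fun n : ℕ =>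
      w ^ (2 * m + 1 - N) / (2 * m + 1 - N).factorial *
        homogeneousPart D μ (2 * m + 1) n N / √(n : ℝ) ^ (2 * m)) atTop (𝓝 0) := by
    intro N hN
    rw [Finset.mem_range] at hN
    have h0 : Tendsto (fun n : ℕ => (√(n : ℝ) ^ (2 * m - N))⁻¹) atTop (𝓝 0) :=
      ((tendsto_pow_atTop (by omega)).comp tendsto_sqrt_natCast_atTop).inv_tendsto_atTop
    have h1 := ((tendsto_homogeneousPart_div hD μ (2 * m + 1) N).mul h0).const_mul
      (w ^ (2 * m + 1 - N) / ((2 * m + 1 - N).factorial : ℝ))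
    rw [mul_zero, mul_zero] at h1
    refine h1.congr' ?_
    filter_upwards [eventually_gt_atTop 0] with n hn
    have hq0 : √(n : ℝ) ≠ 0 := by positivity
    rw [show √(n : ℝ) ^ (2 * m) = √(n : ℝ) ^ N * √(n : ℝ) ^ (2 * m - N) by
      rw [← pow_add]; congr 1; omega]
    field_simp
  have h := (tendsto_finsetSum _ hlow).add
    ((tendsto_homogeneousPart_div hD μ (2 * m + 1) (2 * m)).const_mul w)
  rw [Finset.sum_const_zero, zero_add] at h
  refine h.congr fun n => ?_
  rw [Finset.sum_range_succ, Finset.sum_range_succ, homogeneousPart_of_odd _ _ _ _ ⟨m, rfl⟩,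
    show 2 * m + 1 - 2 * m = 1 by omega]
  simp [add_div, Finset.sum_div, mul_div_assoc]

theorem risingFactorial_pos {y : ℝ} (hy : 0 < y) (k : ℕ) : 0 < risingFactorial y k :=
  Finset.prod_pos fun i _ => by positivity

/-- Up to a positive factor, the coefficients `B^1_{n,n-(2m+1)}` converge to a positive multiple
of `2r + μ + 1`. -/
theorem exists_pos_tendsto_mul_B {D : ℝ} (hD : 4 ≤ D) {r : ℝ} (hr : -1 < r) (μ : ℝ) (m : ℕ) :
    ∃ (C : ℝ) (u : ℕ → ℝ), 0 < C ∧ (∀ᶠ n in atTop, 0 < u n) ∧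
      Tendsto (fun n => u n * B 1 n (n - (2 * m + 1)) r μ D) atTop
        (𝓝 (C * (2 * r + μ + 1))) := by
  refine ⟨expSqCoeff (1 / 48) (2 * m) / 2, fun n => (1 / risingFactorial (r + 1) n *
    ((((n : ℝ) - 3 * μ) / 2) ^ (n - (2 * m + 1)) * n.factorial *
      moment ((D - 4) / 2 + ((n - (2 * m + 1) : ℕ) : ℝ)) 0) * √(n : ℝ) ^ (2 * m))⁻¹,
    ?_, ?_, ?_⟩
  · rw [expSqCoeff_two_mul]
    positivity
  all_goals
    have hpos : ∀ᶠ n : ℕ in atTop, 0 < 1 / risingFactorial (r + 1) n *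
        ((((n : ℝ) - 3 * μ) / 2) ^ (n - (2 * m + 1)) * n.factorial *
          moment ((D - 4) / 2 + ((n - (2 * m + 1) : ℕ) : ℝ)) 0) := by
      filter_upwards [tendsto_natCast_atTop_atTop.eventually_gt_atTop (3 * μ)] with n hn
      have h1 := risingFactorial_pos (by linarith : 0 < r + 1) n
      have h2 : 0 < ((n : ℝ) - 3 * μ) / 2 := by linarith
      have h3 : 0 < moment ((D - 4) / 2 + ((n - (2 * m + 1) : ℕ) : ℝ)) 0 :=
        moment_zero_pos (add_nonneg (by linarith) (by positivity))
      positivity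
  · filter_upwards [hpos, eventually_gt_atTop 0] with n hn hn0
    positivity
  · have h := tendsto_sum_homogeneousPart_div hD μ ((2 * r + μ + 1) / 2) m
    rw [show expSqCoeff (1 / 48) (2 * m) / 2 * (2 * r + μ + 1) =
      (2 * r + μ + 1) / 2 * expSqCoeff (1 / 48) (2 * m) by ring]
    refine h.congr' ?_
    filter_upwards [hpos, eventually_ge_atTop (2 * m + 1)] with n hn hnm
    have hn0 : 0 < n := by omega
    have hq0 : √(n : ℝ) ^ (2 * m) ≠ 0 := by positivity
    rw [B_eq_sum_homogeneousPart hD r μ hn0 hnm, mul_inv, mul_mul_mul_comm,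
      inv_mul_cancel₀ hn.ne', one_mul, inv_mul_eq_div]

/-- Regge-trajectory asymptotics (Section 5.3), odd offset: for fixed odd `Δ`,
the coefficients `B^1_{n,n-Δ}` eventually have the strict sign of `2r + μ + 1`. -/
theorem regge_asymptotics_odd (Δ : ℕ) (hΔ : Odd Δ) (D : ℤ) (hD : 4 ≤ D)
    (r μ : ℝ) (hr : -1 < r) (hw : 2 * r + μ + 1 ≠ 0) :
    ∃ N : ℕ, ∀ n : ℕ, N ≤ n →
      B 1 n (n - Δ) r μ (D : ℝ) ≠ 0 ∧
      (0 < 2 * r + μ + 1 → 0 < B 1 n (n - Δ) r μ (D : ℝ)) ∧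
      (2 * r + μ + 1 < 0 → B 1 n (n - Δ) r μ (D : ℝ) < 0) := by
  obtain ⟨m, rfl⟩ := hΔ
  obtain ⟨C, u, hC, hu, hlim⟩ :=
    exists_pos_tendsto_mul_B (D := (D : ℝ)) (by exact_mod_cast hD) hr μ m
  rw [← eventually_atTop]
  rcases hw.lt_or_gt with h | h
  · filter_upwards [hu, hlim.eventually_lt_const (mul_neg_of_pos_of_neg hC h)] with n hn hB
    have hneg := neg_of_mul_neg_right hB hn.le
    exact ⟨hneg.ne, fun h' => absurd h' h.not_gt, fun _ => hneg⟩
  · filter_upwards [hu, hlim.eventually_const_lt (mul_pos hC h)] with n hn hB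
    have hpos := (mul_pos_iff_of_pos_left hn).1 hB
    exact ⟨hpos.ne', fun _ => hpos, fun h' => absurd h' h.not_gt⟩
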